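/- arXiv:2003.10194 — 6 statements merged into one kernel-verified Lean document; each statement's English description precedes it below -/
import Mathlib

section
/- Let U ⊆ ℂ be an open set, let Φ : U → ℂ be holomorphic with Φ(z) ≠ 0 for all z ∈ U, and let F : U → ℂ be holomorphic with F′(z) = 1/Φ(z) on U. For a holomorphic function g on U define (Dg)(z) = Φ(z)·g′(z). Fix an integer r ≥ 1 and a nonzero constant c ∈ ℂ, and set f_r = c·F^{r−1}. Then the (r−1)-fold iterate of D applied to f_r equals the nonzero constant function c·(r−1)! on U, and the r-fold iterate of D applied to f_r vanishes identically on U. -/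
/-- If `F` has derivative `1 / Φ` on the open set `U` and `D g = Φ · deriv g`, then the iterates of `D`
on `c · F ^ n` are those of the usual derivative on `c · X ^ n`, evaluated at `F`. -/
theorem iterate_mul_deriv_const_mul_pow {U : Set ℂ} (hU : IsOpen U) {Φ F : ℂ → ℂ}
    (hΦ0 : ∀ z ∈ U, Φ z ≠ 0) (hF : ∀ z ∈ U, HasDerivAt F (1 / Φ z) z)
    {D : (ℂ → ℂ) → (ℂ → ℂ)} (hD : ∀ g z, D g z = Φ z * deriv g z)
    {f : ℂ → ℂ} {c : ℂ} {n : ℕ} (hf : ∀ z, f z = c * F z ^ n) (k : ℕ) :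
    ∀ z ∈ U, D^[k] f z = c * (n.descFactorial k : ℂ) * F z ^ (n - k) := by
  induction k with
  | zero => simp [hf]
  | succ k ih =>
    intro z hz
    have hderiv : HasDerivAt (D^[k] f)
        (c * (n.descFactorial k : ℂ) * (((n - k : ℕ) : ℂ) * F z ^ (n - k - 1) * (1 / Φ z))) z :=
      (((hF z hz).fun_pow (n - k)).const_mul _).congr_of_eventuallyEq
        (Filter.eventuallyEq_of_mem (hU.mem_nhds hz) ih)
    have hz0 := hΦ0 z hz
    rw [Function.iterate_succ_apply', hD, hderiv.deriv, Nat.descFactorial_succ, Nat.cast_mul,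
      Nat.sub_sub]
    field_simp

/-- ODE core of Theorem 3.4, case (1). Let `Φ` be holomorphic and
nonvanishing on an open `U ⊆ ℂ`, let `F` be a holomorphic antiderivative of `1/Φ` on `U`,
and let `D g = Φ · g′`. For `r ≥ 1` and `c ≠ 0`, set `f = c · F^{r−1}`. Then `D^[r−1] f`
equals the nonzero constant `c·(r−1)!` on `U` and `D^[r] f` vanishes identically on `U`. -/
theorem iterate_D_pow_antiderivative
    (U : Set ℂ) (hU : IsOpen U)
    (Φ : ℂ → ℂ) (hΦ : DifferentiableOn ℂ Φ U) (hΦ0 : ∀ z ∈ U, Φ z ≠ 0)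
    (F : ℂ → ℂ) (hF : ∀ z ∈ U, HasDerivAt F (1 / Φ z) z)
    (r : ℕ) (hr : 1 ≤ r) (c : ℂ) (hc : c ≠ 0)
    (D : (ℂ → ℂ) → (ℂ → ℂ)) (hD : ∀ g z, D g z = Φ z * deriv g z)
    (f : ℂ → ℂ) (hf : ∀ z, f z = c * (F z) ^ (r - 1)) :
    (∀ z ∈ U, D^[r - 1] f z = c * ((r - 1).factorial : ℂ)) ∧
      (∀ z ∈ U, D^[r] f z = 0) := by
  have key := iterate_mul_deriv_const_mul_pow hU hΦ0 hF hD hf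
  refine ⟨fun z hz => ?_, fun z hz => ?_⟩
  · simp [key _ z hz, Nat.descFactorial_self]
  · simp [key _ z hz, Nat.descFactorial_eq_zero_iff_lt.mpr (Nat.sub_one_lt_of_lt hr)]
end

section
/- Let U ⊆ ℂ be a nonempty open, preconnected, simply connected set, and let Φ, Ψ : U → ℂ be holomorphic with Ψ(z) ≠ 0 for all z ∈ U. Then there exists a sequence (f_r)_{r≥1} of holomorphic functions f_r : U → ℂ such that f_1 is non-constant, Ψ·f_1″ + Φ·f_1′ = 0 on U, and Ψ·f_r″ + Φ·f_r′ = f_{r−1} on U for every r ≥ 2. In particular, no f_r vanishes identically on U. -/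
open Set Filter Topology

/-- On a simply connected space, local functions which pairwise differ by locally constant
functions glue, up to locally constant functions, to a global one. -/
theorem exists_forall_eventually_sub_eq {X ι G : Type*} [TopologicalSpace X]
    [SimplyConnectedSpace X] [LocallyPathConnectedSpace X] [AddCommGroup G]
    (V : ι → Set X) (hVo : ∀ i, IsOpen (V i)) (hV : ∀ x, ∃ i, x ∈ V i) (g : ι → X → G)
    (hg : ∀ i j, ∀ x ∈ V i ∩ V j, ∀ᶠ y in 𝓝 x, g i y - g j y = g i x - g j x) :
    ∃ h : X → G, ∀ i, ∀ x ∈ V i, ∀ᶠ y in 𝓝 x, h y - g i y = h x - g i x := by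
  let _ : TopologicalSpace G := ⊥
  have _ : DiscreteTopology G := ⟨rfl⟩
  choose idx hidx using hV
  let Z : FiberBundleCore ι X G :=
    { baseSet := V
      isOpen_baseSet := hVo
      indexAt := idx
      mem_baseSet_at := hidx
      coordChange := fun i j x v ↦ v + (g i x - g j x)
      coordChange_self := fun i x _ v ↦ by simp
      continuousOn_coordChange := by
        rintro i j ⟨x, v⟩ ⟨hx, -⟩
        refine ContinuousAt.continuousWithinAt ?_
        refine (continuousAt_const (y := v + (g i x - g j x))).congr ?_
        rw [nhds_prod_eq]
        filter_upwards [(hg i j x hx).prod_mk (pb := (· = v)) (by simp [nhds_discrete])]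
          with p hp
        rw [hp.1, hp.2]
      coordChange_comp := fun i j k x _ v ↦ by abel }
  have cov : IsCoveringMap Z.proj := FiberBundle.isCoveringMap (F := G) (E := Z.Fiber)
  obtain ⟨x₀⟩ : Nonempty X := inferInstance
  obtain ⟨s, ⟨-, hs⟩, -⟩ :=
    cov.existsUnique_continuousMap_lifts (ContinuousMap.id X) x₀ (⟨x₀, (0 : G)⟩ : Z.TotalSpace) rfl
  have hs' (x : X) : (s x).proj = x := congrFun hs x
  refine ⟨fun x ↦ (show G from (s x).2) + g (idx x) x, fun i x hx ↦ ?_⟩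
  have hc : ContinuousAt (fun y ↦ (Z.localTriv i (s y)).2) x :=
    continuousAt_snd.comp <| ((Z.localTriv i).continuousAt
      (by rw [Z.mem_localTriv_source, hs' x]; exact hx)).comp s.continuous.continuousAt
  have key (y : X) : (Z.localTriv i (s y)).2 =
      (show G from (s y).2) + g (idx y) y - g i y := by
    rw [Z.localTriv_apply]
    simp only [Z, hs' y]
    abel
  have := hc.eventually (isOpen_discrete {(Z.localTriv i (s x)).2} |>.mem_nhds rfl)
  filter_upwards [this] with y hy
  rw [← key, ← key]
  exact hy

/-- A holomorphic function on a simply connected open set has a primitive. -/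
theorem DifferentiableOn.isExactOn_of_isSimplyConnected {U : Set ℂ} (hU : IsOpen U)
    (hsc : IsSimplyConnected U) {f : ℂ → ℂ} (hf : DifferentiableOn ℂ f U) :
    Complex.IsExactOn f U := by
  have := hsc.simplyConnectedSpace
  have := hU.locallyPathConnectedSpace
  have hball (z : U) : ∃ r > 0, Metric.ball (z : ℂ) r ⊆ U := Metric.isOpen_iff.mp hU z z.2
  choose r hr hrU using hball
  have hprim (z : U) : Complex.IsExactOn f (Metric.ball (z : ℂ) (r z)) :=
    (hf.mono (hrU z)).isExactOn_ball
  choose g hg using hprim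
  have hnhds (x : U) (p : ℂ → Prop) : (∀ᶠ y in 𝓝 (x : ℂ), p y) ↔ ∀ᶠ y : U in 𝓝 x, p y := by
    rw [eventually_nhds_subtype_iff, hU.nhdsWithin_eq x.2]
  obtain ⟨h, hh⟩ := exists_forall_eventually_sub_eq
    (fun z : U ↦ (Subtype.val ⁻¹' Metric.ball (z : ℂ) (r z) : Set U))
    (fun z ↦ Metric.isOpen_ball.preimage continuous_subtype_val)
    (fun z ↦ ⟨z, Metric.mem_ball_self (hr z)⟩) (fun z x ↦ g z x) (by
      rintro i j x ⟨hi, hj⟩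
      refine (hnhds x fun y ↦ g i y - g j y = g i x - g j x).mp ?_
      set W := Metric.ball (i : ℂ) (r i) ∩ Metric.ball (j : ℂ) (r j)
      have hWo : IsOpen W := Metric.isOpen_ball.inter Metric.isOpen_ball
      have hWc : IsPreconnected W :=
        ((convex_ball _ _).inter (convex_ball _ _)).isPreconnected
      have hd (y : ℂ) (hy : y ∈ W) : HasDerivAt (fun y ↦ g i y - g j y) 0 y := by
        simpa using (hg i y hy.1).fun_sub (hg j y hy.2)
      filter_upwards [hWo.mem_nhds ⟨hi, hj⟩] with y hy
      exact hWo.is_const_of_deriv_eq_zero hWc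
        (fun y hy ↦ (hd y hy).differentiableAt.differentiableWithinAt)
        (fun y hy ↦ (hd y hy).deriv) hy ⟨hi, hj⟩)
  classical
  let H : ℂ → ℂ := fun z ↦ if hz : z ∈ U then h ⟨z, hz⟩ else 0
  refine ⟨H, fun z hz ↦ ?_⟩
  have hH (y : U) : H y = h y := by simp [H]
  have hloc := hh ⟨z, hz⟩ ⟨z, hz⟩ (Metric.mem_ball_self (hr _))
  have hev : ∀ᶠ y in 𝓝 z, H y = g ⟨z, hz⟩ y + (H z - g ⟨z, hz⟩ z) := by
    refine (hnhds ⟨z, hz⟩ _).mpr ?_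
    filter_upwards [hloc] with y hy
    have hHz : H z = h ⟨z, hz⟩ := hH ⟨z, hz⟩
    rw [hH, hHz, ← hy]
    ring
  exact ((hg ⟨z, hz⟩ z (Metric.mem_ball_self (hr _))).add_const _).congr_of_eventuallyEq hev

/-- On a simply connected open set, the equation `f″ + (Φ / Ψ) f′ = h / Ψ` with holomorphic data
is solved by means of an integrating factor; the initial slope can be prescribed. -/
theorem exists_differentiableOn_mul_deriv_deriv_add_mul_deriv_eq {U : Set ℂ} (hU : IsOpen U)
    (hsc : IsSimplyConnected U) {Φ Ψ h : ℂ → ℂ} (hΦ : DifferentiableOn ℂ Φ U)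
    (hΨ : DifferentiableOn ℂ Ψ U) (hΨ0 : ∀ z ∈ U, Ψ z ≠ 0) (hh : DifferentiableOn ℂ h U)
    (z₀ c : ℂ) (hz₀ : z₀ ∈ U) :
    ∃ f : ℂ → ℂ, DifferentiableOn ℂ f U ∧ deriv f z₀ = c ∧
      ∀ z ∈ U, Ψ z * deriv (deriv f) z + Φ z * deriv f z = h z := by
  obtain ⟨P, hP⟩ := DifferentiableOn.isExactOn_of_isSimplyConnected hU hsc
    (f := fun z ↦ -(Φ z / Ψ z)) (hΦ.fun_div hΨ hΨ0).fun_neg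
  have hΛ (z : ℂ) (hz : z ∈ U) := (hP z hz).cexp
  have hΛd : DifferentiableOn ℂ (fun z ↦ Complex.exp (P z)) U :=
    fun z hz ↦ (hΛ z hz).differentiableAt.differentiableWithinAt
  obtain ⟨Q, hQ₀, hQ⟩ := (DifferentiableOn.isExactOn_of_isSimplyConnected hU hsc
    (f := fun z ↦ h z / (Complex.exp (P z) * Ψ z)) (hh.fun_div (hΛd.fun_mul hΨ)
      fun z hz ↦ mul_ne_zero (Complex.exp_ne_zero _) (hΨ0 z hz))).with_val_at z₀
    (c / Complex.exp (P z₀))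
  obtain ⟨f, hf⟩ := DifferentiableOn.isExactOn_of_isSimplyConnected hU hsc
    (f := fun z ↦ Complex.exp (P z) * Q z)
    (hΛd.fun_mul fun z hz ↦ (hQ z hz).differentiableAt.differentiableWithinAt)
  refine ⟨f, fun z hz ↦ (hf z hz).differentiableAt.differentiableWithinAt, ?_, fun z hz ↦ ?_⟩
  · simp only [(hf z₀ hz₀).deriv, hQ₀, mul_div_cancel₀ _ (Complex.exp_ne_zero (P z₀))]
  · have hev : deriv f =ᶠ[𝓝 z] fun z ↦ Complex.exp (P z) * Q z := by
      filter_upwards [hU.mem_nhds hz] with y hy using (hf y hy).deriv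
    rw [hev.deriv_eq, (hf z hz).deriv, ((hΛ z hz).fun_mul (hQ z hz)).deriv]
    have := hΨ0 z hz
    have := Complex.exp_ne_zero (P z)
    field_simp
    ring


/-- ODE core of Theorem 3.4, case (2). Let `U ⊆ ℂ` be nonempty, open,
preconnected and simply connected, and let `Φ, Ψ` be holomorphic on `U` with `Ψ` nonvanishing
on `U`. Then there is a sequence `(f_r)_{r ≥ 1}` of holomorphic functions on `U` with `f₁`
non-constant on `U`, `Ψ·f₁″ + Φ·f₁′ = 0` on `U`, and `Ψ·f_r″ + Φ·f_r′ = f_{r−1}` on `U`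
for all `r ≥ 2`; in particular no `f_r` (`r ≥ 1`) vanishes identically on `U`. -/
theorem exists_sequence_ode_solutions
    (U : Set ℂ) (hne : U.Nonempty) (hU : IsOpen U) (hconn : IsPreconnected U)
    (hsc : SimplyConnectedSpace U)
    (Φ Ψ : ℂ → ℂ) (hΦ : DifferentiableOn ℂ Φ U) (hΨ : DifferentiableOn ℂ Ψ U)
    (hΨ0 : ∀ z ∈ U, Ψ z ≠ 0) :
    ∃ f : ℕ → ℂ → ℂ,
      (∀ r, 1 ≤ r → DifferentiableOn ℂ (f r) U) ∧
      (¬ ∀ z ∈ U, ∀ w ∈ U, f 1 z = f 1 w) ∧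
      (∀ z ∈ U, Ψ z * deriv (deriv (f 1)) z + Φ z * deriv (f 1) z = 0) ∧
      (∀ r, 2 ≤ r → ∀ z ∈ U,
        Ψ z * deriv (deriv (f r)) z + Φ z * deriv (f r) z = f (r - 1) z) ∧
      (∀ r, 1 ≤ r → ∃ z ∈ U, f r z ≠ 0) := by
  obtain ⟨z₀, hz₀⟩ := hne
  have solve (h : ℂ → ℂ) (hh : DifferentiableOn ℂ h U) (c : ℂ) :=
    exists_differentiableOn_mul_deriv_deriv_add_mul_deriv_eq hU hsc hΦ hΨ hΨ0 hh z₀ c hz₀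
  obtain ⟨f₁, hf₁, hc, hode⟩ := solve 0 (differentiableOn_const 0) 1
  choose S hSd _ hS using fun h : {h : ℂ → ℂ // DifferentiableOn ℂ h U} ↦ solve h h.2 0
  let F : ℕ → {h : ℂ → ℂ // DifferentiableOn ℂ h U} :=
    fun n ↦ Nat.rec ⟨f₁, hf₁⟩ (fun _ h ↦ ⟨S h, hSd h⟩) n
  have deriv_zero_of_const (f : ℂ → ℂ) (a : ℂ) (hf : ∀ z ∈ U, f z = a) (z : ℂ) (hz : z ∈ U) :
      deriv f z = 0 := by
    have : f =ᶠ[𝓝 z] fun _ ↦ a := by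
      filter_upwards [hU.mem_nhds hz] with y hy using hf y hy
    rw [this.deriv_eq, deriv_const]
  have hnonconst : ¬ ∀ z ∈ U, ∀ w ∈ U, f₁ z = f₁ w := fun hconst ↦ by
    have := deriv_zero_of_const f₁ (f₁ z₀) (fun z hz ↦ hconst z hz z₀ hz₀) z₀ hz₀
    exact one_ne_zero (hc.symm.trans this)
  have hF (n : ℕ) (z : ℂ) (hz : z ∈ U) :
      Ψ z * deriv (deriv (F (n + 1)).1) z + Φ z * deriv (F (n + 1)).1 z = (F n).1 z :=
    hS (F n) z hz
  refine ⟨fun r ↦ (F (r - 1)).1, fun r _ ↦ (F (r - 1)).2, hnonconst, hode, ?_, ?_⟩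
  · intro r hr z hz
    obtain ⟨n, rfl⟩ := Nat.exists_eq_add_of_le' hr
    exact hF n z hz
  · suffices ∀ n, ∃ z ∈ U, (F n).1 z ≠ 0 from fun r _ ↦ this (r - 1)
    intro n
    induction n with
    | zero =>
      by_contra! hzero
      exact hnonconst fun z hz w hw ↦ (hzero z hz).trans (hzero w hw).symm
    | succ n ih =>
      by_contra! hzero
      obtain ⟨z, hz, hne⟩ := ih
      have hd := deriv_zero_of_const _ 0 hzero
      have hdd := deriv_zero_of_const _ 0 hd z hz
      exact hne (by rw [← hF n z hz, hdd, hd z hz, mul_zero, mul_zero, add_zero])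
end

section
/- For every integer r ≥ 1 and every nonzero pair (a_1,a_2) ∈ ℂ², the function φ : ℝ × ℝ³ → ℂ defined by φ(t,x) = a_1 x_3^{2r−1} + a_2 x_3^{2r−2} satisfies τ^r(φ) ≡ 0 and τ^{r−1}(φ) ≢ 0, i.e. it is proper r-harmonic on the Lie group G_{4.1}. -/
open Matrix BigOperators

/-- Directional (partial) derivative of a complex-valued function along `v`. -/
noncomputable def pder {E : Type*} [NormedAddCommGroup E] [NormedSpace ℝ E]
    (v : E) (f : E → ℂ) (p : E) : ℂ :=
  fderiv ℝ f p v

/-- Unit vector in the `t`-direction on `ℝ × ℝ³`. -/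
def eT : ℝ × (Fin 3 → ℝ) := (1, 0)

/-- Unit vector in the `x_i`-direction on `ℝ × ℝ³`. -/
def eX (i : Fin 3) : ℝ × (Fin 3 → ℝ) := (0, Pi.single i 1)

/-- `μ(t)μ(t)ᵀ` for the group `G₄.₁ = ℝ ⋉_A ℝ³`, where `μ(t) = Exp(tA)` and `A` is the
nilpotent matrix with `A₁₂ = A₂₃ = 1`. -/
noncomputable def M41 (t : ℝ) : Matrix (Fin 3) (Fin 3) ℝ :=
  !![1 + t ^ 2 + t ^ 4 / 4, t + t ^ 3 / 2, t ^ 2 / 2;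
     t + t ^ 3 / 2, 1 + t ^ 2, t;
     t ^ 2 / 2, t, 1]

/-- The Laplace–Beltrami (tension) operator on `G₄.₁`:
`τ(φ) = ∂²φ/∂t² + ∑ᵢⱼ (μ(t)μ(t)ᵀ)ᵢⱼ ∂²φ/∂xᵢ∂xⱼ`. -/
noncomputable def tension41 (f : ℝ × (Fin 3 → ℝ) → ℂ) (p : ℝ × (Fin 3 → ℝ)) : ℂ :=
  pder eT (pder eT f) p
    + ∑ i, ∑ j, ((M41 p.1) i j : ℂ) * pder (eX i) (pder (eX j) f) p

/-- The iterated Laplace–Beltrami operator on `G₄.₁`. -/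
noncomputable def tension41Iter : ℕ → (ℝ × (Fin 3 → ℝ) → ℂ) → (ℝ × (Fin 3 → ℝ) → ℂ)
  | 0, f => f
  | r + 1, f => tension41 (tension41Iter r f)

/-- The function `(t, x) ↦ P(x₃)` attached to a complex polynomial `P`. -/
noncomputable def thirdCoordEval (P : Polynomial ℂ) (p : ℝ × (Fin 3 → ℝ)) : ℂ :=
  P.eval (p.2 2 : ℂ)

theorem pder_thirdCoordEval (v : ℝ × (Fin 3 → ℝ)) (P : Polynomial ℂ) :
    pder v (thirdCoordEval P) =
      thirdCoordEval (Polynomial.C (v.2 2 : ℂ) * Polynomial.derivative P) := by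
  funext p
  let L : ℝ × (Fin 3 → ℝ) →L[ℝ] ℂ :=
    Complex.ofRealCLM.comp ((ContinuousLinearMap.proj 2).comp (ContinuousLinearMap.snd ℝ ℝ _))
  have hP : HasFDerivAt (fun z : ℂ => P.eval z)
      ((ContinuousLinearMap.toSpanSingleton ℂ (P.derivative.eval (L p))).restrictScalars ℝ)
      (L p) :=
    (P.hasDerivAt (L p)).hasFDerivAt.restrictScalars ℝ
  have h : HasFDerivAt (thirdCoordEval P) _ p := hP.comp p L.hasFDerivAt
  simp [pder, h.fderiv, thirdCoordEval, L]

theorem tension41_thirdCoordEval (P : Polynomial ℂ) :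
    tension41 (thirdCoordEval P) =
      thirdCoordEval (Polynomial.derivative (Polynomial.derivative P)) := by
  funext p
  simp [tension41, pder_thirdCoordEval, eT, eX, M41, Fin.sum_univ_three, thirdCoordEval,
    Pi.single_apply]

theorem tension41Iter_thirdCoordEval (k : ℕ) (P : Polynomial ℂ) :
    tension41Iter k (thirdCoordEval P) = thirdCoordEval (Polynomial.derivative^[2 * k] P) := by
  induction k with
  | zero => rfl
  | succ k ih =>
    rw [tension41Iter, ih, tension41_thirdCoordEval, Nat.mul_succ,
      Function.iterate_succ_apply', Function.iterate_succ_apply']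

/-- Example 5.9. For `r ≥ 1` and `(a₁,a₂) ≠ 0`, the function
`φ(t,x) = a₁ x₃^{2r−1} + a₂ x₃^{2r−2}` is proper `r`-harmonic on `G₄.₁`. -/
theorem proper_r_harmonic_G41
    (r : ℕ) (hr : 1 ≤ r) (a₁ a₂ : ℂ) (ha : ¬ (a₁ = 0 ∧ a₂ = 0))
    (φ : ℝ × (Fin 3 → ℝ) → ℂ)
    (hφ : ∀ (t : ℝ) (x : Fin 3 → ℝ),
      φ (t, x) = a₁ * (x 2 : ℂ) ^ (2 * r - 1) + a₂ * (x 2 : ℂ) ^ (2 * r - 2)) :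
    (∀ p, tension41Iter r φ p = 0) ∧ (∃ p, tension41Iter (r - 1) φ p ≠ 0) := by
  obtain ⟨s, rfl⟩ : ∃ s, r = s + 1 := ⟨r - 1, by omega⟩
  have e₁ : 2 * (s + 1) - 1 = 2 * s + 1 := by omega
  have e₂ : 2 * (s + 1) - 2 = 2 * s := by omega
  rw [e₁, e₂] at hφ
  have hφP : φ = thirdCoordEval
      (Polynomial.C a₁ * Polynomial.X ^ (2 * s + 1) + Polynomial.C a₂ * Polynomial.X ^ (2 * s)) := by
    funext ⟨t, x⟩
    simp [hφ, thirdCoordEval]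
  have hD : Polynomial.derivative^[2 * s]
      (Polynomial.C a₁ * Polynomial.X ^ (2 * s + 1) + Polynomial.C a₂ * Polynomial.X ^ (2 * s)) =
      Polynomial.C (a₁ * ((2 * s + 1).descFactorial (2 * s) : ℂ)) * Polynomial.X +
        Polynomial.C (a₂ * ((2 * s).descFactorial (2 * s) : ℂ)) := by
    rw [iterate_map_add, Polynomial.iterate_derivative_C_mul,
      Polynomial.iterate_derivative_C_mul, Polynomial.iterate_derivative_X_pow_eq_C_mul,
      Polynomial.iterate_derivative_X_pow_eq_C_mul, Nat.add_sub_cancel_left, Nat.sub_self]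
    simp [mul_assoc]
  rw [hφP]
  constructor
  · intro p
    rw [tension41Iter_thirdCoordEval, Nat.mul_succ, Function.iterate_succ_apply',
      Function.iterate_succ_apply', hD]
    simp [thirdCoordEval]
  · rw [Nat.add_sub_cancel, tension41Iter_thirdCoordEval, hD]
    by_cases h : a₂ = 0
    · have h' : a₁ ≠ 0 := fun h' => ha ⟨h', h⟩
      exact ⟨(0, 1), by simp [thirdCoordEval, h, h']⟩
    · exact ⟨(0, 0), by simp [thirdCoordEval, h]⟩
end

section
/- Let p, q, r ≥ 1 be integers with r + q − 1 = p, and let (c_1,c_2) ∈ ℂ² and (a_1,a_2) ∈ ℂ² both be nonzero. Then the function (t,x) ↦ (c_1 t^{2r−1} + c_2 t^{2r−2})(a_1 x_3^{2q−1} + a_2 x_3^{2q−2}) satisfies τ^p ≡ 0 and τ^{p−1} ≢ 0, i.e. it is proper p-harmonic on the Lie group G_{4.1}. -/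
open Matrix BigOperators

open scoped TensorProduct Polynomial

/-- The function on `ℝ × ℝ³` given by `(t, x) ↦ P(t) Q(x₃)`, extended linearly to tensors. -/
noncomputable def tensorEval : ℂ[X] ⊗[ℂ] ℂ[X] →ₗ[ℂ] (ℝ × (Fin 3 → ℝ) → ℂ) :=
  TensorProduct.lift (LinearMap.mk₂ ℂ
    (fun P Q z => P.eval (z.1 : ℂ) * Q.eval (z.2 2 : ℂ))
    (fun P P' Q => by ext z; simp [add_mul])
    (fun c P Q => by ext z; simp [mul_assoc])
    (fun P Q Q' => by ext z; simp [mul_add])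
    (fun c P Q => by ext z; simp [mul_left_comm]))

lemma tensorEval_tmul (P Q : ℂ[X]) :
    tensorEval (P ⊗ₜ Q) = fun z => P.eval (z.1 : ℂ) * Q.eval (z.2 2 : ℂ) := rfl

/-- Differentiation in the first tensor factor. -/
noncomputable def derivLeft : Module.End ℂ (ℂ[X] ⊗[ℂ] ℂ[X]) :=
  LinearMap.rTensor ℂ[X] Polynomial.derivative

/-- Differentiation in the second tensor factor. -/
noncomputable def derivRight : Module.End ℂ (ℂ[X] ⊗[ℂ] ℂ[X]) :=
  LinearMap.lTensor ℂ[X] Polynomial.derivative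

lemma hasFDerivAt_tensorEval_tmul (P Q : ℂ[X]) (z : ℝ × (Fin 3 → ℝ)) :
    ∃ L : ℝ × (Fin 3 → ℝ) →L[ℝ] ℂ, HasFDerivAt (tensorEval (P ⊗ₜ Q)) L z ∧
      ∀ v, L v = (v.1 : ℂ) * tensorEval (derivLeft (P ⊗ₜ Q)) z
        + (v.2 2 : ℂ) * tensorEval (derivRight (P ⊗ₜ Q)) z := by
  have h1 := (P.hasDerivAt (z.1 : ℂ)).comp_ofReal.hasFDerivAt.comp z
    (ContinuousLinearMap.fst ℝ ℝ (Fin 3 → ℝ)).hasFDerivAt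
  have h2 := (Q.hasDerivAt (z.2 2 : ℂ)).comp_ofReal.hasFDerivAt.comp z
    ((ContinuousLinearMap.proj (R := ℝ) (φ := fun _ : Fin 3 => ℝ) 2).comp
      (ContinuousLinearMap.snd ℝ ℝ (Fin 3 → ℝ))).hasFDerivAt
  refine ⟨_, h1.mul h2, fun v => ?_⟩
  simp [derivLeft, derivRight, tensorEval_tmul]
  ring

lemma hasFDerivAt_tensorEval (w : ℂ[X] ⊗[ℂ] ℂ[X]) (z : ℝ × (Fin 3 → ℝ)) :
    ∃ L : ℝ × (Fin 3 → ℝ) →L[ℝ] ℂ, HasFDerivAt (tensorEval w) L z ∧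
      ∀ v, L v = (v.1 : ℂ) * tensorEval (derivLeft w) z
        + (v.2 2 : ℂ) * tensorEval (derivRight w) z := by
  induction w with
  | zero => exact ⟨0, by rw [map_zero]; exact hasFDerivAt_const 0 z, by simp⟩
  | tmul P Q => exact hasFDerivAt_tensorEval_tmul P Q z
  | add w₁ w₂ h₁ h₂ =>
    obtain ⟨L₁, hL₁, e₁⟩ := h₁
    obtain ⟨L₂, hL₂, e₂⟩ := h₂
    refine ⟨L₁ + L₂, by rw [map_add]; exact hL₁.add hL₂, fun v => ?_⟩
    simp only [_root_.add_apply, e₁, e₂, map_add, Pi.add_apply]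
    ring

lemma pder_tensorEval (v : ℝ × (Fin 3 → ℝ)) (w : ℂ[X] ⊗[ℂ] ℂ[X]) :
    pder v (tensorEval w) =
      tensorEval ((v.1 : ℂ) • derivLeft w + (v.2 2 : ℂ) • derivRight w) := by
  ext z
  obtain ⟨L, hL, e⟩ := hasFDerivAt_tensorEval w z
  simp [pder, hL.fderiv, e]

lemma pder_zero {E : Type*} [NormedAddCommGroup E] [NormedSpace ℝ E] (v : E) :
    pder v (0 : E → ℂ) = 0 := by
  ext z
  simp [pder]

lemma tension41_tensorEval (w : ℂ[X] ⊗[ℂ] ℂ[X]) :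
    tension41 (tensorEval w) = tensorEval ((derivLeft ^ 2 + derivRight ^ 2) w) := by
  ext z
  simp [tension41, pder_tensorEval, pder_zero, Fin.sum_univ_three, eT, eX, M41, pow_two]

lemma tension41Iter_tensorEval (n : ℕ) (w : ℂ[X] ⊗[ℂ] ℂ[X]) :
    tension41Iter n (tensorEval w) = tensorEval (((derivLeft ^ 2 + derivRight ^ 2) ^ n) w) := by
  induction n with
  | zero => rfl
  | succ n ih => rw [tension41Iter, ih, tension41_tensorEval, pow_succ' _ n, Module.End.mul_apply]

lemma commute_derivLeft_derivRight : Commute derivLeft derivRight :=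
  (LinearMap.rTensor_comp_lTensor _ _ _).trans (LinearMap.lTensor_comp_rTensor _ _ _).symm

lemma derivLeft_pow_mul_derivRight_pow_tmul (m n : ℕ) (P Q : ℂ[X]) :
    (derivLeft ^ m * derivRight ^ n) (P ⊗ₜ Q) =
      (Polynomial.derivative^[m] P) ⊗ₜ (Polynomial.derivative^[n] Q) := by
  rw [derivLeft, derivRight, LinearMap.rTensor_pow, LinearMap.lTensor_pow, Module.End.mul_apply,
    LinearMap.lTensor_tmul, LinearMap.rTensor_tmul, Module.End.pow_apply, Module.End.pow_apply]

lemma tension41Iter_tensorEval_tmul (n : ℕ) (P Q : ℂ[X]) :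
    tension41Iter n (tensorEval (P ⊗ₜ Q)) = fun z => ∑ m ∈ Finset.range (n + 1),
      (n.choose m : ℂ) * ((Polynomial.derivative^[2 * m] P).eval (z.1 : ℂ)
        * (Polynomial.derivative^[2 * (n - m)] Q).eval (z.2 2 : ℂ)) := by
  ext z
  rw [tension41Iter_tensorEval, (commute_derivLeft_derivRight.pow_pow 2 2).add_pow,
    LinearMap.sum_apply, map_sum, Finset.sum_apply]
  refine Finset.sum_congr rfl fun m _ => ?_
  rw [← pow_mul, ← pow_mul, ← nsmul_eq_mul', LinearMap.smul_apply,
    derivLeft_pow_mul_derivRight_pow_tmul, map_nsmul, tensorEval_tmul]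
  simp

lemma iterate_derivative_two_terms_eq_zero (c₁ c₂ : ℂ) {r m : ℕ} (hr : 1 ≤ r) (hm : r ≤ m) :
    Polynomial.derivative^[2 * m] (Polynomial.C c₁ * Polynomial.X ^ (2 * r - 1)
      + Polynomial.C c₂ * Polynomial.X ^ (2 * r - 2)) = 0 := by
  apply Polynomial.iterate_derivative_eq_zero
  refine lt_of_le_of_lt (b := 2 * r - 1) ?_ (by omega)
  refine Polynomial.natDegree_add_le_of_degree_le (Polynomial.natDegree_C_mul_X_pow_le _ _)
    ((Polynomial.natDegree_C_mul_X_pow_le _ _).trans (by omega))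

lemma exists_eval_iterate_derivative_two_terms_ne_zero {c₁ c₂ : ℂ} (hc : ¬ (c₁ = 0 ∧ c₂ = 0))
    {r : ℕ} (hr : 1 ≤ r) :
    ∃ t : ℝ, (Polynomial.derivative^[2 * (r - 1)] (Polynomial.C c₁ * Polynomial.X ^ (2 * r - 1)
      + Polynomial.C c₂ * Polynomial.X ^ (2 * r - 2))).eval (t : ℂ) ≠ 0 := by
  obtain ⟨s, rfl⟩ := Nat.exists_eq_add_of_le' hr
  have key : ∀ t : ℝ, (Polynomial.derivative^[2 * (s + 1 - 1)]
      (Polynomial.C c₁ * Polynomial.X ^ (2 * (s + 1) - 1)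
        + Polynomial.C c₂ * Polynomial.X ^ (2 * (s + 1) - 2))).eval (t : ℂ)
      = c₁ * ((2 * s + 1).factorial * t) + c₂ * (2 * s).factorial := by
    intro t
    have h1 : 2 * (s + 1) - 1 = 2 * s + 1 := by omega
    have h2 : 2 * (s + 1) - 2 = 2 * s := by omega
    have h3 : (2 * s + 1).descFactorial (2 * s) = (2 * s + 1).factorial := by
      have := Nat.factorial_mul_descFactorial (show 2 * s ≤ 2 * s + 1 by omega)
      simpa using this
    rw [h1, h2, Nat.add_sub_cancel, iterate_map_add,
      Polynomial.iterate_derivative_C_mul, Polynomial.iterate_derivative_C_mul,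
      Polynomial.iterate_derivative_X_pow_eq_natCast_mul,
      Polynomial.iterate_derivative_X_pow_eq_natCast_mul, h3, Nat.descFactorial_self]
    simp
  by_cases h : c₂ = 0
  · refine ⟨1, ?_⟩
    rw [key]
    have h' : c₁ ≠ 0 := fun h' => hc ⟨h', h⟩
    simp [h, h', Nat.factorial_ne_zero]
  · refine ⟨0, ?_⟩
    rw [key]
    simp [h, Nat.factorial_ne_zero]


/-- Example 5.9. For integers `p, q, r ≥ 1` with `r + q − 1 = p` and
nonzero pairs `(c₁,c₂), (a₁,a₂) ∈ ℂ²`, the function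
`(t,x) ↦ (c₁ t^{2r−1} + c₂ t^{2r−2})(a₁ x₃^{2q−1} + a₂ x₃^{2q−2})` is proper `p`-harmonic
on `G₄.₁`. -/
theorem proper_p_harmonic_product_G41
    (p q r : ℕ) (hp : 1 ≤ p) (hq : 1 ≤ q) (hr : 1 ≤ r) (hpqr : r + q - 1 = p)
    (c₁ c₂ : ℂ) (hc : ¬ (c₁ = 0 ∧ c₂ = 0))
    (a₁ a₂ : ℂ) (ha : ¬ (a₁ = 0 ∧ a₂ = 0))
    (φ : ℝ × (Fin 3 → ℝ) → ℂ)
    (hφ : ∀ (t : ℝ) (x : Fin 3 → ℝ),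
      φ (t, x) = (c₁ * (t : ℂ) ^ (2 * r - 1) + c₂ * (t : ℂ) ^ (2 * r - 2))
        * (a₁ * (x 2 : ℂ) ^ (2 * q - 1) + a₂ * (x 2 : ℂ) ^ (2 * q - 2))) :
    (∀ z, tension41Iter p φ z = 0) ∧ (∃ z, tension41Iter (p - 1) φ z ≠ 0) := by
  obtain rfl : φ = tensorEval ((Polynomial.C c₁ * Polynomial.X ^ (2 * r - 1)
      + Polynomial.C c₂ * Polynomial.X ^ (2 * r - 2)) ⊗ₜ
      (Polynomial.C a₁ * Polynomial.X ^ (2 * q - 1)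
        + Polynomial.C a₂ * Polynomial.X ^ (2 * q - 2))) := by
    ext ⟨t, x⟩
    simp [hφ, tensorEval_tmul]
  simp only [tension41Iter_tensorEval_tmul]
  constructor
  · intro z
    refine Finset.sum_eq_zero fun m _ => ?_
    rcases le_or_gt r m with h | h
    · simp [iterate_derivative_two_terms_eq_zero c₁ c₂ hr h]
    · simp [iterate_derivative_two_terms_eq_zero a₁ a₂ hq (show q ≤ p - m by omega)]
  · obtain ⟨t, ht⟩ := exists_eval_iterate_derivative_two_terms_ne_zero hc hr
    obtain ⟨s, hs⟩ := exists_eval_iterate_derivative_two_terms_ne_zero ha hq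
    refine ⟨(t, fun _ => s), ?_⟩
    rw [Finset.sum_eq_single (r - 1)]
    · rw [show p - 1 - (r - 1) = q - 1 by omega]
      exact mul_ne_zero (Nat.cast_ne_zero.2 (Nat.choose_pos (by omega)).ne') (mul_ne_zero ht hs)
    · intro m _ hm
      rcases le_or_gt r m with h | h
      · simp [iterate_derivative_two_terms_eq_zero c₁ c₂ hr h]
      · simp [iterate_derivative_two_terms_eq_zero a₁ a₂ hq (show q ≤ p - 1 - m by omega)]
    · intro h
      exact absurd (Finset.mem_range.2 (by omega)) h
end

section
/- For every integer r ≥ 1 and all nonzero tuples c = (c_1,c_2) ∈ ℂ² and a = (a_1,a_2,a_3,a_4) ∈ ℂ⁴, the function (t,x) ↦ (c_1 t^{r−1}e^{3t} + c_2 t^{r−1})·(a_1 + a_2 x_1 + a_3 x_2 + a_4(x_2² − x_3² − 2x_1x_3)) satisfies τ^r ≡ 0 and τ^{r−1} ≢ 0, i.e. it is proper r-harmonic on the Lie group G_{4.4}. -/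
open Matrix BigOperators

/-- `μ(t)μ(t)ᵀ` for the group `G₄.₄ = ℝ ⋉_A ℝ³` with `A = [[1,1,0],[0,1,1],[0,0,1]]`:
`μ(t)μ(t)ᵀ = e^{2t}·[[1+t²+t⁴/4, t+t³/2, t²/2],[t+t³/2, 1+t², t],[t²/2, t, 1]]`. -/
noncomputable def M44 (t : ℝ) : Matrix (Fin 3) (Fin 3) ℝ :=
  Real.exp (2 * t) •
    !![1 + t ^ 2 + t ^ 4 / 4, t + t ^ 3 / 2, t ^ 2 / 2;
       t + t ^ 3 / 2, 1 + t ^ 2, t;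
       t ^ 2 / 2, t, 1]

/-- The Laplace–Beltrami (tension) operator on `G₄.₄`:
`τ(φ) = ∂²φ/∂t² − 3∂φ/∂t + ∑ᵢⱼ (μ(t)μ(t)ᵀ)ᵢⱼ ∂²φ/∂xᵢ∂xⱼ`. -/
noncomputable def tension44 (f : ℝ × (Fin 3 → ℝ) → ℂ) (p : ℝ × (Fin 3 → ℝ)) : ℂ :=
  pder eT (pder eT f) p - 3 * pder eT f p
    + ∑ i, ∑ j, ((M44 p.1) i j : ℂ) * pder (eX i) (pder (eX j) f) p

/-- The iterated Laplace–Beltrami operator on `G₄.₄`. -/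
noncomputable def tension44Iter : ℕ → (ℝ × (Fin 3 → ℝ) → ℂ) → (ℝ × (Fin 3 → ℝ) → ℂ)
  | 0, f => f
  | r + 1, f => tension44 (tension44Iter r f)

open Polynomial

theorem pder_eT_mul {g : ℝ → ℂ} {g' : ℂ} {Q : (Fin 3 → ℝ) → ℂ} {p : ℝ × (Fin 3 → ℝ)}
    (hg : HasDerivAt g g' p.1) (hQ : DifferentiableAt ℝ Q p.2) :
    pder eT (fun p : ℝ × (Fin 3 → ℝ) => g p.1 * Q p.2) p = g' * Q p.2 := by
  have h₁ := hg.hasFDerivAt.comp p hasFDerivAt_fst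
  have h₂ := hQ.hasFDerivAt.comp p hasFDerivAt_snd
  have h := (h₁.mul h₂).fderiv
  simp only [Function.comp_def, Pi.mul_def] at h
  simp [pder, h, eT, mul_comm]

theorem pder_eX_mul {g : ℝ → ℂ} {Q : (Fin 3 → ℝ) → ℂ} {p : ℝ × (Fin 3 → ℝ)} (i : Fin 3)
    (hg : DifferentiableAt ℝ g p.1) (hQ : DifferentiableAt ℝ Q p.2) :
    pder (eX i) (fun p : ℝ × (Fin 3 → ℝ) => g p.1 * Q p.2) p
      = g p.1 * pder (Pi.single i 1) Q p.2 := by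
  have h₁ := hg.hasFDerivAt.comp p hasFDerivAt_fst
  have h₂ := hQ.hasFDerivAt.comp p hasFDerivAt_snd
  have h := (h₁.mul h₂).fderiv
  simp only [Function.comp_def, Pi.mul_def] at h
  simp [pder, h, eX]

/-- The quadratic polynomials spanned by `1`, `x₁`, `x₂` and `x₂² − x₃² − 2x₁x₃`. -/
noncomputable def quad44 (a₁ a₂ a₃ a₄ : ℂ) (x : Fin 3 → ℝ) : ℂ :=
  a₁ + a₂ * (x 0 : ℂ) + a₃ * (x 1 : ℂ)
    + a₄ * ((x 1 : ℂ) ^ 2 - (x 2 : ℂ) ^ 2 - 2 * (x 0 : ℂ) * (x 2 : ℂ))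

/-- The affine functions on `ℝ³`. -/
noncomputable def affine44 (b : ℂ) (l : Fin 3 → ℂ) (x : Fin 3 → ℝ) : ℂ :=
  b + l 0 * (x 0 : ℂ) + l 1 * (x 1 : ℂ) + l 2 * (x 2 : ℂ)

theorem hasFDerivAt_ofReal_coord (i : Fin 3) (x : Fin 3 → ℝ) :
    HasFDerivAt (fun y : Fin 3 → ℝ => (y i : ℂ))
      (Complex.ofRealCLM.comp (ContinuousLinearMap.proj i)) x :=
  (Complex.ofRealCLM.comp (ContinuousLinearMap.proj (R := ℝ) (φ := fun _ => ℝ) i)).hasFDerivAt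

theorem differentiable_quad44 (a₁ a₂ a₃ a₄ : ℂ) : Differentiable ℝ (quad44 a₁ a₂ a₃ a₄) := by
  have h := fun i x => (hasFDerivAt_ofReal_coord i x).differentiableAt
  intro x
  unfold quad44
  have h0 := h 0 x
  have h1 := h 1 x
  have h2 := h 2 x
  fun_prop

theorem differentiable_affine44 (b : ℂ) (l : Fin 3 → ℂ) : Differentiable ℝ (affine44 b l) := by
  have h := fun i x => (hasFDerivAt_ofReal_coord i x).differentiableAt
  intro x
  unfold affine44
  have h0 := h 0 x
  have h1 := h 1 x
  have h2 := h 2 x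
  fun_prop

theorem pder_affine44 (b : ℂ) (l : Fin 3 → ℂ) (i : Fin 3) (x : Fin 3 → ℝ) :
    pder (Pi.single i 1) (affine44 b l) x = l i := by
  have h := hasFDerivAt_ofReal_coord
  have H := ((((h 0 x).const_mul (l 0)).const_add b).add ((h 1 x).const_mul (l 1))).add
    ((h 2 x).const_mul (l 2))
  have H' : HasFDerivAt (affine44 b l) _ x := H
  rw [pder, H'.fderiv]
  fin_cases i <;> simp

theorem pder_quad44 (a₁ a₂ a₃ a₄ : ℂ) (i : Fin 3) :
    pder (Pi.single i 1) (quad44 a₁ a₂ a₃ a₄)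
      = affine44 (![a₂, a₃, 0] i)
          (![![0, 0, -2 * a₄], ![0, 2 * a₄, 0], ![-2 * a₄, 0, -2 * a₄]] i) := by
  funext x
  have h := hasFDerivAt_ofReal_coord
  have H := ((((h 0 x).const_mul a₂).const_add a₁).add ((h 1 x).const_mul a₃)).add
    (((((h 1 x).pow 2).sub ((h 2 x).pow 2)).sub
      (((h 0 x).const_mul 2).mul (h 2 x))).const_mul a₄)
  have H' : HasFDerivAt (quad44 a₁ a₂ a₃ a₄) _ x := H
  rw [pder, H'.fderiv]
  fin_cases i <;> simp [affine44] <;> ring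

/-- The function `p(t) e^{3t} + q(t)` of a real variable. -/
noncomputable def expPoly (p q : ℂ[X]) (t : ℝ) : ℂ :=
  p.eval (t : ℂ) * (Real.exp (3 * t) : ℂ) + q.eval (t : ℂ)

theorem hasDerivAt_expPoly (p q : ℂ[X]) (t : ℝ) :
    HasDerivAt (expPoly p q) (expPoly (derivative p + C 3 * p) (derivative q) t) t := by
  have he : HasDerivAt (fun t : ℝ => (Real.exp (3 * t) : ℂ))
      ((Real.exp (3 * t) * (3 * 1) : ℝ) : ℂ) t :=
    (((hasDerivAt_id t).const_mul 3).exp).ofReal_comp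
  have H : HasDerivAt (expPoly p q) _ t :=
    ((p.hasDerivAt (t : ℂ)).comp_ofReal.mul he).add (q.hasDerivAt (t : ℂ)).comp_ofReal
  convert H using 1
  simp [expPoly]
  ring

/-- The constant-coefficient differential operator `D ∘ (D + c)` on polynomials. -/
noncomputable def derivShift (c : ℂ) : Module.End ℂ ℂ[X] :=
  (derivative + c • 1) * derivative

theorem tension44_expPoly_mul_quad44 (p q : ℂ[X]) (a₁ a₂ a₃ a₄ : ℂ) :
    tension44 (fun z => expPoly p q z.1 * quad44 a₁ a₂ a₃ a₄ z.2)
      = fun z => expPoly (derivShift 3 p) (derivShift (-3) q) z.1 * quad44 a₁ a₂ a₃ a₄ z.2 := by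
  have hT (p q : ℂ[X]) : pder eT (fun z => expPoly p q z.1 * quad44 a₁ a₂ a₃ a₄ z.2)
      = fun z => expPoly (derivative p + C 3 * p) (derivative q) z.1
          * quad44 a₁ a₂ a₃ a₄ z.2 :=
    funext fun z => pder_eT_mul (hasDerivAt_expPoly p q z.1) (differentiable_quad44 _ _ _ _ _)
  have hX (j : Fin 3) : pder (eX j) (fun z => expPoly p q z.1 * quad44 a₁ a₂ a₃ a₄ z.2)
      = fun z => expPoly p q z.1 * pder (Pi.single j 1) (quad44 a₁ a₂ a₃ a₄) z.2 :=
    funext fun z => pder_eX_mul j (hasDerivAt_expPoly p q z.1).differentiableAt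
      (differentiable_quad44 _ _ _ _ _)
  funext z
  have hXX (i j : Fin 3) :
      pder (eX i) (pder (eX j) (fun z => expPoly p q z.1 * quad44 a₁ a₂ a₃ a₄ z.2)) z
      = expPoly p q z.1 *
        ![![0, 0, -2 * a₄], ![0, 2 * a₄, 0], ![-2 * a₄, 0, -2 * a₄]] j i := by
    rw [hX, pder_quad44, pder_eX_mul i (hasDerivAt_expPoly p q z.1).differentiableAt
      (differentiable_affine44 _ _ _), pder_affine44]
  simp only [tension44, hXX, hT, Fin.sum_univ_three]
  simp [M44, expPoly, derivShift]
  ring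

theorem tension44Iter_expPoly_mul_quad44 (p q : ℂ[X]) (a₁ a₂ a₃ a₄ : ℂ) (n : ℕ) :
    tension44Iter n (fun z => expPoly p q z.1 * quad44 a₁ a₂ a₃ a₄ z.2)
      = fun z => expPoly ((derivShift 3 ^ n) p) ((derivShift (-3) ^ n) q) z.1
          * quad44 a₁ a₂ a₃ a₄ z.2 := by
  induction n with
  | zero => rfl
  | succ n ih => rw [tension44Iter, ih, tension44_expPoly_mul_quad44, pow_succ', pow_succ']; rfl

theorem derivShift_pow (c : ℂ) (n : ℕ) :
    derivShift c ^ n = (derivative + c • 1) ^ n * (derivative : Module.End ℂ ℂ[X]) ^ n :=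
  ((Commute.refl _).add_left ((Commute.one_left _).smul_left c)).mul_pow n

theorem derivShift_pow_succ_monomial (c b : ℂ) (n : ℕ) :
    (derivShift c ^ (n + 1)) (C b * X ^ n) = 0 := by
  rw [derivShift_pow, Module.End.mul_apply, Module.End.pow_apply derivative,
    iterate_derivative_eq_zero ((natDegree_C_mul_X_pow_le b n).trans_lt n.lt_succ_self), map_zero]

theorem derivShift_pow_monomial (c b : ℂ) (n : ℕ) :
    (derivShift c ^ n) (C b * X ^ n) = C (c ^ n * (n.factorial * b)) := by
  have h (k : ℕ) (d : ℂ) :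
      ((derivative + c • 1 : Module.End ℂ ℂ[X]) ^ k) (C d) = C (c ^ k * d) := by
    induction k with
    | zero => simp
    | succ k ih =>
      rw [pow_succ', Module.End.mul_apply, ih, LinearMap.add_apply, derivative_C, zero_add,
        LinearMap.smul_apply, Module.End.one_apply, smul_C, smul_eq_mul, pow_succ', mul_assoc]
  rw [derivShift_pow, Module.End.mul_apply, Module.End.pow_apply derivative, ← h]
  congr 1
  rw [iterate_derivative_C_mul, iterate_derivative_X_pow_eq_smul]
  simp [Nat.descFactorial_self, mul_comm]

theorem exists_expPoly_C_ne_zero {A B : ℂ} (h : ¬ (A = 0 ∧ B = 0)) :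
    ∃ t, expPoly (C A) (C B) t ≠ 0 := by
  by_contra! H
  have h0 := H 0
  have h1 := H 1
  simp only [expPoly, eval_C, mul_zero, Real.exp_zero, Complex.ofReal_one, mul_one] at h0 h1
  have he : (Real.exp 3 : ℂ) - 1 ≠ 0 := by
    rw [sub_ne_zero]
    exact_mod_cast (Real.one_lt_exp_iff.2 (by norm_num : (0 : ℝ) < 3)).ne'
  have hA : A = 0 := by
    have : A * ((Real.exp 3 : ℂ) - 1) = 0 := by linear_combination h1 - h0
    exact (mul_eq_zero.1 this).resolve_right he
  exact h ⟨hA, by simpa [hA] using h0⟩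

theorem exists_quad44_ne_zero {a₁ a₂ a₃ a₄ : ℂ}
    (ha : ¬ (a₁ = 0 ∧ a₂ = 0 ∧ a₃ = 0 ∧ a₄ = 0)) : ∃ x, quad44 a₁ a₂ a₃ a₄ x ≠ 0 := by
  by_contra! H
  have h0 := H 0
  have h1 := H ![1, 0, 0]
  have h2 := H ![0, 1, 0]
  have h3 := H ![0, -1, 0]
  simp [quad44] at h0 h1 h2 h3
  refine ha ⟨h0, ?_, ?_, ?_⟩
  · linear_combination h1 - h0
  · linear_combination (h2 - h3) / 2
  · linear_combination (h2 + h3) / 2 - h0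

/-- Example 5.6. For `r ≥ 1` and nonzero `c ∈ ℂ²`, `a ∈ ℂ⁴`, the function
`(t,x) ↦ (c₁ t^{r−1}e^{3t} + c₂ t^{r−1})·(a₁ + a₂x₁ + a₃x₂ + a₄(x₂² − x₃² − 2x₁x₃))`
is proper `r`-harmonic on `G₄.₄`. -/
theorem proper_r_harmonic_G44
    (r : ℕ) (hr : 1 ≤ r)
    (c₁ c₂ : ℂ) (hc : ¬ (c₁ = 0 ∧ c₂ = 0))
    (a₁ a₂ a₃ a₄ : ℂ) (ha : ¬ (a₁ = 0 ∧ a₂ = 0 ∧ a₃ = 0 ∧ a₄ = 0))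
    (φ : ℝ × (Fin 3 → ℝ) → ℂ)
    (hφ : ∀ (t : ℝ) (x : Fin 3 → ℝ),
      φ (t, x) = (c₁ * (t : ℂ) ^ (r - 1) * (Real.exp (3 * t) : ℂ) + c₂ * (t : ℂ) ^ (r - 1))
        * (a₁ + a₂ * (x 0 : ℂ) + a₃ * (x 1 : ℂ)
            + a₄ * ((x 1 : ℂ) ^ 2 - (x 2 : ℂ) ^ 2 - 2 * (x 0 : ℂ) * (x 2 : ℂ)))) :
    (∀ p, tension44Iter r φ p = 0) ∧ (∃ p, tension44Iter (r - 1) φ p ≠ 0) := by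
  obtain ⟨n, rfl⟩ : ∃ n, r = n + 1 := ⟨r - 1, by omega⟩
  obtain rfl : φ = fun z => expPoly (C c₁ * X ^ n) (C c₂ * X ^ n) z.1
      * quad44 a₁ a₂ a₃ a₄ z.2 := by
    funext ⟨t, x⟩
    simp [hφ, expPoly, quad44]
  simp only [tension44Iter_expPoly_mul_quad44, Nat.add_sub_cancel,
    derivShift_pow_succ_monomial, derivShift_pow_monomial]
  refine ⟨fun z => by simp [expPoly], ?_⟩
  obtain ⟨x, hx⟩ := exists_quad44_ne_zero ha
  obtain ⟨t, ht⟩ := exists_expPoly_C_ne_zero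
    (A := 3 ^ n * (n.factorial * c₁)) (B := (-3) ^ n * (n.factorial * c₂))
    (by simpa [Nat.factorial_ne_zero] using hc)
  exact ⟨(t, x), mul_ne_zero ht hx⟩
end

section
/- For every ν = (ν_1,ν_2) ∈ ℂ², the functions φ_±(t,x) = e^{−(ν_1 t_1 + ν_2 t_2)}(x_1 ± i x_2) on ℝ² × ℝ² satisfy τ(φ_±) = (ν_1² − 2ν_1 + ν_2²)·φ_± and κ(φ_±, φ_±) = (ν_1² + ν_2²)·φ_±²; in particular φ_± are eigenfunctions on the Lie group G_{4.10}. -/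
open BigOperators

/-- Unit coordinate vectors `(t₁, t₂, x₁, x₂)` on `G₄.₁₀ = ℝ² ⋉ ℝ²`. -/
def eT1 : ℝ × ℝ × ℝ × ℝ := (1, 0, 0, 0)
def eT2 : ℝ × ℝ × ℝ × ℝ := (0, 1, 0, 0)
def eX1 : ℝ × ℝ × ℝ × ℝ := (0, 0, 1, 0)
def eX2 : ℝ × ℝ × ℝ × ℝ := (0, 0, 0, 1)

/-- The Laplace–Beltrami (tension) operator on `G₄.₁₀`:
`τ(φ) = ∂²φ/∂t₁² + ∂²φ/∂t₂² + 2∂φ/∂t₁ + e^{−2t₁}(∂²φ/∂x₁² + ∂²φ/∂x₂²)`. -/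
noncomputable def tension410 (f : ℝ × ℝ × ℝ × ℝ → ℂ) (p : ℝ × ℝ × ℝ × ℝ) : ℂ :=
  pder eT1 (pder eT1 f) p + pder eT2 (pder eT2 f) p + 2 * pder eT1 f p
    + (Real.exp (-(2 * p.1)) : ℂ)
        * (pder eX1 (pder eX1 f) p + pder eX2 (pder eX2 f) p)

/-- The conformality operator on `G₄.₁₀`:
`κ(φ,ψ) = (∂φ/∂t₁)(∂ψ/∂t₁) + (∂φ/∂t₂)(∂ψ/∂t₂)`
`+ e^{−2t₁}((∂φ/∂x₁)(∂ψ/∂x₁) + (∂φ/∂x₂)(∂ψ/∂x₂))`. -/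
noncomputable def conf410 (f g : ℝ × ℝ × ℝ × ℝ → ℂ) (p : ℝ × ℝ × ℝ × ℝ) : ℂ :=
  pder eT1 f p * pder eT1 g p + pder eT2 f p * pder eT2 g p
    + (Real.exp (-(2 * p.1)) : ℂ)
        * (pder eX1 f p * pder eX1 g p + pder eX2 f p * pder eX2 g p)

/-- The product of the exponential character `e^{−(ν₁t₁+ν₂t₂)}` with the affine function
`a x₁ + b x₂ + d`. -/
noncomputable def expAffine (ν₁ ν₂ a b d : ℂ) (p : ℝ × ℝ × ℝ × ℝ) : ℂ :=
  Complex.exp (-(ν₁ * (p.1 : ℂ) + ν₂ * (p.2.1 : ℂ))) *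
    (a * (p.2.2.1 : ℂ) + b * (p.2.2.2 : ℂ) + d)

theorem pder_expAffine (ν₁ ν₂ a b d : ℂ) (v : ℝ × ℝ × ℝ × ℝ) :
    pder v (expAffine ν₁ ν₂ a b d) =
      expAffine ν₁ ν₂ (-(ν₁ * v.1 + ν₂ * v.2.1) * a) (-(ν₁ * v.1 + ν₂ * v.2.1) * b)
        (-(ν₁ * v.1 + ν₂ * v.2.1) * d + (a * v.2.2.1 + b * v.2.2.2)) := by
  funext p
  have h₁ : HasFDerivAt (fun q : ℝ × ℝ × ℝ × ℝ ↦ (q.1 : ℂ)) _ p :=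
    Complex.ofRealCLM.hasFDerivAt.comp p hasFDerivAt_fst
  have h₂ : HasFDerivAt (fun q : ℝ × ℝ × ℝ × ℝ ↦ (q.2.1 : ℂ)) _ p :=
    Complex.ofRealCLM.hasFDerivAt.comp p hasFDerivAt_snd.fst
  have h₃ : HasFDerivAt (fun q : ℝ × ℝ × ℝ × ℝ ↦ (q.2.2.1 : ℂ)) _ p :=
    Complex.ofRealCLM.hasFDerivAt.comp p hasFDerivAt_snd.snd.fst
  have h₄ : HasFDerivAt (fun q : ℝ × ℝ × ℝ × ℝ ↦ (q.2.2.2 : ℂ)) _ p :=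
    Complex.ofRealCLM.hasFDerivAt.comp p hasFDerivAt_snd.snd.snd
  have h : HasFDerivAt (expAffine ν₁ ν₂ a b d) _ p :=
    ((h₁.const_mul ν₁).add (h₂.const_mul ν₂)).neg.cexp.mul
      (((h₃.const_mul a).add (h₄.const_mul b)).add_const d)
  rw [pder, h.fderiv]
  simp [expAffine]
  ring

theorem tension410_expAffine {ν₁ ν₂ a b : ℂ} (p : ℝ × ℝ × ℝ × ℝ) :
    tension410 (expAffine ν₁ ν₂ a b 0) p =
      (ν₁ ^ 2 - 2 * ν₁ + ν₂ ^ 2) * expAffine ν₁ ν₂ a b 0 p := by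
  simp only [tension410, pder_expAffine]
  simp [expAffine, eT1, eT2, eX1, eX2]
  ring

theorem conf410_expAffine {ν₁ ν₂ a b : ℂ} (hab : a ^ 2 + b ^ 2 = 0) (p : ℝ × ℝ × ℝ × ℝ) :
    conf410 (expAffine ν₁ ν₂ a b 0) (expAffine ν₁ ν₂ a b 0) p =
      (ν₁ ^ 2 + ν₂ ^ 2) * expAffine ν₁ ν₂ a b 0 p ^ 2 := by
  simp only [conf410, pder_expAffine]
  simp only [expAffine, eT1, eT2, eX1, eX2, Complex.ofReal_zero, Complex.ofReal_one]
  linear_combination (Real.exp (-(2 * p.1)) : ℂ) *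
    Complex.exp (-(ν₁ * (p.1 : ℂ) + ν₂ * (p.2.1 : ℂ))) ^ 2 * hab

/-- Example 5.13. For every `ν = (ν₁,ν₂) ∈ ℂ²` the functions
`φ±(t,x) = e^{−(ν₁t₁+ν₂t₂)}(x₁ ± i x₂)` satisfy `τ(φ±) = (ν₁² − 2ν₁ + ν₂²)·φ±` and
`κ(φ±,φ±) = (ν₁² + ν₂²)·φ±²`; in particular they are eigenfunctions on `G₄.₁₀`. -/
theorem eigenfunctions_G410
    (ν₁ ν₂ : ℂ) (φp φm : ℝ × ℝ × ℝ × ℝ → ℂ)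
    (hφp : ∀ (t₁ t₂ x₁ x₂ : ℝ), φp (t₁, t₂, x₁, x₂)
      = Complex.exp (-(ν₁ * (t₁ : ℂ) + ν₂ * (t₂ : ℂ))) * ((x₁ : ℂ) + Complex.I * (x₂ : ℂ)))
    (hφm : ∀ (t₁ t₂ x₁ x₂ : ℝ), φm (t₁, t₂, x₁, x₂)
      = Complex.exp (-(ν₁ * (t₁ : ℂ) + ν₂ * (t₂ : ℂ))) * ((x₁ : ℂ) - Complex.I * (x₂ : ℂ))) :
    (∀ p, tension410 φp p = (ν₁ ^ 2 - 2 * ν₁ + ν₂ ^ 2) * φp p) ∧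
      (∀ p, conf410 φp φp p = (ν₁ ^ 2 + ν₂ ^ 2) * (φp p) ^ 2) ∧
      (∀ p, tension410 φm p = (ν₁ ^ 2 - 2 * ν₁ + ν₂ ^ 2) * φm p) ∧
      (∀ p, conf410 φm φm p = (ν₁ ^ 2 + ν₂ ^ 2) * (φm p) ^ 2) := by
  obtain rfl : φp = expAffine ν₁ ν₂ 1 Complex.I 0 := by
    funext ⟨t₁, t₂, x₁, x₂⟩
    simp [hφp, expAffine]
  obtain rfl : φm = expAffine ν₁ ν₂ 1 (-Complex.I) 0 := by
    funext ⟨t₁, t₂, x₁, x₂⟩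
    simp [hφm, expAffine, sub_eq_add_neg]
  exact ⟨tension410_expAffine, conf410_expAffine (by simp), tension410_expAffine,
    conf410_expAffine (by simp)⟩
end
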